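/- For all x > 0 and y > 0: ∂³BS_Put/∂x∂y² (x,y) = −(φ(d_+(x,y))/(2·y²)) · ( d_+(x,y)·d_−(x,y)²/2 − d_+(x,y)/2 − d_−(x,y) ). -/

import Mathlib

/-- Density of the standard normal distribution. -/
noncomputable def stdGaussianPDF (z : ℝ) : ℝ :=
  (Real.sqrt (2 * Real.pi))⁻¹ * Real.exp (-z ^ 2 / 2)

/-- Cumulative distribution function of the standard normal distribution. -/
noncomputable def stdGaussianCDF (z : ℝ) : ℝ :=
  ∫ t in Set.Iic z, stdGaussianPDF t

/-- d₊ from the Black–Scholes formula. -/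
noncomputable def dPlus (K r T x y : ℝ) : ℝ :=
  (Real.log (x / K) + r * T + y / 2) / Real.sqrt y

/-- d₋ from the Black–Scholes formula. -/
noncomputable def dMinus (K r T x y : ℝ) : ℝ :=
  (Real.log (x / K) + r * T - y / 2) / Real.sqrt y

/-- Black–Scholes put price with strike `K`, interest rate `r`, maturity `T`,
spot `x` and integrated variance `y`. -/
noncomputable def BSPut (K r T x y : ℝ) : ℝ :=
  K * Real.exp (-(r * T)) * stdGaussianCDF (-(dMinus K r T x y)) -
    x * stdGaussianCDF (-(dPlus K r T x y))

theorem continuous_stdGaussianPDF : Continuous stdGaussianPDF := by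
  unfold stdGaussianPDF
  fun_prop

theorem integrable_stdGaussianPDF : MeasureTheory.Integrable stdGaussianPDF := by
  refine ((integrable_exp_neg_mul_sq (b := 1 / 2) (by norm_num)).const_mul
    (Real.sqrt (2 * Real.pi))⁻¹).congr (.of_forall fun z => ?_)
  simp only [stdGaussianPDF]
  congr 2
  ring

theorem stdGaussianPDF_neg (z : ℝ) : stdGaussianPDF (-z) = stdGaussianPDF z := by
  simp [stdGaussianPDF]

theorem hasDerivAt_stdGaussianPDF (z : ℝ) :
    HasDerivAt stdGaussianPDF (-z * stdGaussianPDF z) z := by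
  have h : HasDerivAt (fun z : ℝ => -z ^ 2 / 2) (-z) z := by
    refine ((hasDerivAt_pow 2 z).neg.div_const 2).congr_deriv ?_
    norm_num
    ring
  refine (h.exp.const_mul (Real.sqrt (2 * Real.pi))⁻¹).congr_deriv ?_
  simp only [stdGaussianPDF]
  ring

theorem hasDerivAt_stdGaussianCDF (z : ℝ) :
    HasDerivAt stdGaussianCDF (stdGaussianPDF z) z := by
  have h : stdGaussianCDF = fun w => stdGaussianCDF 0 + ∫ t in (0 : ℝ)..w, stdGaussianPDF t := by
    funext w
    have := intervalIntegral.integral_Iic_sub_Iic (a := 0) (b := w)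
      integrable_stdGaussianPDF.integrableOn integrable_stdGaussianPDF.integrableOn
    simp only [stdGaussianCDF]
    linarith
  rw [h]
  exact (intervalIntegral.integral_hasDerivAt_right
    (continuous_stdGaussianPDF.intervalIntegrable _ _)
    continuous_stdGaussianPDF.stronglyMeasurable.stronglyMeasurableAtFilter
    continuous_stdGaussianPDF.continuousAt).const_add _

theorem hasDerivAt_add_mul_div_sqrt (m c : ℝ) {y : ℝ} (hy : 0 < y) :
    HasDerivAt (fun y => (m + c * y) / Real.sqrt y)
      (-((m - c * y) / Real.sqrt y) / (2 * y)) y := by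
  have hs : Real.sqrt y ≠ 0 := (Real.sqrt_pos.2 hy).ne'
  refine ((((hasDerivAt_id y).const_mul c).const_add m).div
    (Real.hasDerivAt_sqrt hy.ne') hs).congr_deriv ?_
  obtain ⟨s, hs0, rfl⟩ : ∃ s : ℝ, 0 < s ∧ y = s ^ 2 :=
    ⟨Real.sqrt y, Real.sqrt_pos.2 hy, (Real.sq_sqrt hy.le).symm⟩
  simp only [Real.sqrt_sq hs0.le, id]
  field_simp
  ring

theorem hasDerivAt_dPlus_right (K r T x : ℝ) {y : ℝ} (hy : 0 < y) :
    HasDerivAt (dPlus K r T x) (-dMinus K r T x y / (2 * y)) y := by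
  convert hasDerivAt_add_mul_div_sqrt (Real.log (x / K) + r * T) (1 / 2) hy using 1
  · funext y
    rw [dPlus]
    ring
  · rw [dMinus]
    ring

theorem hasDerivAt_dMinus_right (K r T x : ℝ) {y : ℝ} (hy : 0 < y) :
    HasDerivAt (dMinus K r T x) (-dPlus K r T x y / (2 * y)) y := by
  convert hasDerivAt_add_mul_div_sqrt (Real.log (x / K) + r * T) (-1 / 2) hy using 1
  · funext y
    rw [dMinus]
    ring
  · rw [dPlus]
    ring

theorem hasDerivAt_log_div_const {K x : ℝ} (hK : K ≠ 0) (hx : x ≠ 0) :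
    HasDerivAt (fun x => Real.log (x / K)) x⁻¹ x := by
  refine (((hasDerivAt_id x).div_const K).log (div_ne_zero hx hK)).congr_deriv ?_
  simp only [id]
  field_simp

theorem hasDerivAt_dPlus_left {K x : ℝ} (r T y : ℝ) (hK : K ≠ 0) (hx : x ≠ 0) :
    HasDerivAt (fun x => dPlus K r T x y) (x⁻¹ / Real.sqrt y) x :=
  (((hasDerivAt_log_div_const hK hx).add_const _).add_const _).div_const _

theorem hasDerivAt_dMinus_left {K x : ℝ} (r T y : ℝ) (hK : K ≠ 0) (hx : x ≠ 0) :
    HasDerivAt (fun x => dMinus K r T x y) (x⁻¹ / Real.sqrt y) x :=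
  (((hasDerivAt_log_div_const hK hx).add_const _).sub_const _).div_const _

theorem dPlus_sub_dMinus (K r T x : ℝ) {y : ℝ} (hy : 0 < y) :
    dPlus K r T x y - dMinus K r T x y = Real.sqrt y := by
  have hs : Real.sqrt y ≠ 0 := (Real.sqrt_pos.2 hy).ne'
  rw [dPlus, dMinus, ← sub_div, div_eq_iff hs, Real.mul_self_sqrt hy.le]
  ring

theorem discounted_strike_mul_stdGaussianPDF_dMinus {K x y : ℝ} (r T : ℝ) (hK : 0 < K)
    (hx : 0 < x) (hy : 0 < y) :
    K * Real.exp (-(r * T)) * stdGaussianPDF (dMinus K r T x y) =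
      x * stdGaussianPDF (dPlus K r T x y) := by
  have hexp : -dMinus K r T x y ^ 2 / 2 =
      Real.log (x / K) + r * T + -dPlus K r T x y ^ 2 / 2 := by
    have hs : Real.sqrt y ≠ 0 := (Real.sqrt_pos.2 hy).ne'
    rw [dPlus, dMinus, div_pow, div_pow, Real.sq_sqrt hy.le]
    field_simp
    ring
  simp only [stdGaussianPDF]
  rw [hexp, Real.exp_add, Real.exp_add, Real.exp_log (div_pos hx hK), Real.exp_neg]
  field_simp

theorem hasDerivAt_BSPut_right {K x y : ℝ} (r T : ℝ) (hK : 0 < K) (hx : 0 < x) (hy : 0 < y) :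
    HasDerivAt (fun y => BSPut K r T x y)
      (x * stdGaussianPDF (dPlus K r T x y) / (2 * Real.sqrt y)) y := by
  have hm := ((hasDerivAt_stdGaussianCDF (-dMinus K r T x y)).comp y
    (hasDerivAt_dMinus_right K r T x hy).neg).const_mul (K * Real.exp (-(r * T)))
  have hp := ((hasDerivAt_stdGaussianCDF (-dPlus K r T x y)).comp y
    (hasDerivAt_dPlus_right K r T x hy).neg).const_mul x
  refine (hm.sub hp).congr_deriv ?_
  rw [stdGaussianPDF_neg, stdGaussianPDF_neg, ← mul_assoc,
    discounted_strike_mul_stdGaussianPDF_dMinus r T hK hx hy]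
  have hd : dPlus K r T x y = dMinus K r T x y + Real.sqrt y := by
    linarith [dPlus_sub_dMinus K r T x hy]
  have hs := Real.sqrt_pos.2 hy
  have hsq := Real.sq_sqrt hy.le
  generalize stdGaussianPDF (dPlus K r T x y) = p
  rw [hd]
  generalize Real.sqrt y = s at *
  subst hsq
  field_simp
  ring

theorem iteratedDeriv_two_BSPut_right {K x y : ℝ} (r T : ℝ) (hK : 0 < K) (hx : 0 < x)
    (hy : 0 < y) :
    iteratedDeriv 2 (fun y => BSPut K r T x y) y =
      x * stdGaussianPDF (dPlus K r T x y) *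
        (dPlus K r T x y * dMinus K r T x y - 1) / (4 * y * Real.sqrt y) := by
  have hev : deriv (fun y => BSPut K r T x y) =ᶠ[nhds y]
      fun y => x * stdGaussianPDF (dPlus K r T x y) / (2 * Real.sqrt y) := by
    filter_upwards [lt_mem_nhds hy] with z hz
    exact (hasDerivAt_BSPut_right r T hK hx hz).deriv
  rw [iteratedDeriv_succ, iteratedDeriv_one, hev.deriv_eq]
  have hs := Real.sqrt_pos.2 hy
  have h := (((hasDerivAt_stdGaussianPDF (dPlus K r T x y)).comp y
    (hasDerivAt_dPlus_right K r T x hy)).const_mul x).div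
    ((Real.hasDerivAt_sqrt hy.ne').const_mul 2) (by positivity)
  refine h.deriv.trans ?_
  have hsq := Real.sq_sqrt hy.le
  simp only [Function.comp_apply]
  generalize stdGaussianPDF (dPlus K r T x y) = p
  generalize dPlus K r T x y = a
  generalize dMinus K r T x y = b
  generalize Real.sqrt y = s at *
  subst hsq
  field_simp
  ring

/-- Mixed third derivative (formula (5.4), corrected):
`∂³BS_Put/∂x∂y² = −(φ(d₊)/(2y²))·(d₊d₋²/2 − d₊/2 − d₋)` for all `x, y > 0`. -/
theorem bsPut_third_partial_xyy (K r T : ℝ) (hK : 0 < K) (hT : 0 < T) :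
    ∀ x y : ℝ, 0 < x → 0 < y →
      deriv (fun x' => iteratedDeriv 2 (fun y' => BSPut K r T x' y') y) x =
        -(stdGaussianPDF (dPlus K r T x y) / (2 * y ^ 2)) *
          (dPlus K r T x y * dMinus K r T x y ^ 2 / 2 -
            dPlus K r T x y / 2 - dMinus K r T x y) := by
  intro x y hx hy
  have hev : (fun x' => iteratedDeriv 2 (fun y' => BSPut K r T x' y') y) =ᶠ[nhds x]
      fun x' => x' * stdGaussianPDF (dPlus K r T x' y) *
        (dPlus K r T x' y * dMinus K r T x' y - 1) / (4 * y * Real.sqrt y) := by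
    filter_upwards [lt_mem_nhds hx] with z hz
    exact iteratedDeriv_two_BSPut_right r T hK hz hy
  rw [hev.deriv_eq]
  have hp := hasDerivAt_dPlus_left r T y hK.ne' hx.ne'
  have hm := hasDerivAt_dMinus_left r T y hK.ne' hx.ne'
  have h := (((hasDerivAt_id x).mul ((hasDerivAt_stdGaussianPDF (dPlus K r T x y)).comp x hp)).mul
    ((hp.mul hm).sub_const 1)).div_const (4 * y * Real.sqrt y)
  refine h.deriv.trans ?_
  have hd : dPlus K r T x y = dMinus K r T x y + Real.sqrt y := by
    linarith [dPlus_sub_dMinus K r T x hy]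
  have hs := Real.sqrt_pos.2 hy
  have hsq := Real.sq_sqrt hy.le
  simp only [Function.comp_apply, Pi.mul_apply, id]
  generalize stdGaussianPDF (dPlus K r T x y) = p
  rw [hd]
  generalize dMinus K r T x y = b
  generalize Real.sqrt y = s at *
  subst hsq
  field_simp
  ring
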